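/- arXiv:2402.15689 — 2 statements merged into one kernel-verified Lean document; each statement's English description precedes it below -/
import Mathlib

section
/- Let f(z) = Σ_{n=0}^∞ a_n z^n belong to the class B. Then for every r with 0 < r ≤ 1/√2: 1 − S_r/π ≥ (1 − r²)(1 − r²|a₀|⁴)/(1 − |a₀|² r²)², and consequently S_r/(π − S_r) ≤ r² (1 − |a₀|²)² / ( (1 − r²)(1 − r² |a₀|⁴) ), where S_r/π = Σ_{n=1}^∞ n |a_n|² r^{2n}. -/
/-- Membership in the class `B` of analytic self-maps of the unit disk,
together with its Taylor coefficient sequence `a`. -/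
def InClassB (f : ℂ → ℂ) (a : ℕ → ℂ) : Prop :=
  (∀ z : ℂ, ‖z‖ < 1 → HasSum (fun n => a n * z ^ n) (f z)) ∧
  (∀ z : ℂ, ‖z‖ < 1 → ‖f z‖ ≤ 1)

/-- `S_r/π = Σ_{n=1}^∞ n |a_n|² r^{2n}`. -/
noncomputable def SrOverPi (a : ℕ → ℂ) (r : ℝ) : ℝ :=
  ∑' n : ℕ, ((n : ℝ) + 1) * ‖a (n + 1)‖ ^ 2 * r ^ (2 * (n + 1))

open Filter Topology MeasureTheory ComplexConjugate

/-- `F` is the sum on the open unit disk of the power series with coefficients `c`. -/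
def HasDiskSeries (F : ℂ → ℂ) (c : ℕ → ℂ) : Prop :=
  ∀ z : ℂ, ‖z‖ < 1 → HasSum (fun n => c n * z ^ n) (F z)

namespace HasDiskSeries

variable {F G : ℂ → ℂ} {c d : ℕ → ℂ}

theorem hasFPowerSeriesOnBall (h : HasDiskSeries F c) :
    HasFPowerSeriesOnBall F (FormalMultilinearSeries.ofScalars ℂ c) 0 1 where
  r_le := by
    refine ENNReal.le_of_forall_nnreal_lt fun ρ hρ => ?_
    apply FormalMultilinearSeries.le_radius_of_summable_norm
    have hρ' : ‖((ρ : ℝ) : ℂ)‖ < 1 := by simpa using hρ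
    simpa using (h _ hρ').summable.norm
  r_pos := one_pos
  hasSum := by
    intro y hy
    have hy' : ‖y‖ < 1 := by
      rw [← ENNReal.ofReal_one, Metric.eball_ofReal] at hy
      simpa using hy
    simpa [FormalMultilinearSeries.ofScalars_apply_eq, mul_comm] using h y hy'

theorem differentiableOn (h : HasDiskSeries F c) :
    DifferentiableOn ℂ F (Metric.ball 0 1) := by
  have := h.hasFPowerSeriesOnBall.differentiableOn
  rwa [← ENNReal.ofReal_one, Metric.eball_ofReal] at this

theorem unique (h : HasDiskSeries F c) (h' : HasDiskSeries F d) : c = d :=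
  FormalMultilinearSeries.ofScalars_series_injective ℂ ℂ
    (h.hasFPowerSeriesOnBall.hasFPowerSeriesAt.eq_formalMultilinearSeries
      h'.hasFPowerSeriesOnBall.hasFPowerSeriesAt)

theorem congr (h : HasDiskSeries F c) (hFG : ∀ z : ℂ, ‖z‖ < 1 → F z = G z) :
    HasDiskSeries G c := fun z hz => hFG z hz ▸ h z hz

theorem sub (h : HasDiskSeries F c) (h' : HasDiskSeries G d) :
    HasDiskSeries (fun z => F z - G z) (fun n => c n - d n) := fun z hz => by
  simpa only [sub_mul] using (h z hz).sub (h' z hz)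

theorem const_mul (h : HasDiskSeries F c) (b : ℂ) :
    HasDiskSeries (fun z => b * F z) (fun n => b * c n) := fun z hz => by
  simpa only [mul_assoc] using (h z hz).mul_left b

theorem const (b : ℂ) : HasDiskSeries (fun _ => b) (fun n => if n = 0 then b else 0) := by
  intro z _
  have h : HasSum (fun n => (if n = 0 then b else 0) * z ^ n) _ :=
    hasSum_single 0 fun n hn => by simp [hn]
  rwa [if_pos rfl, pow_zero, mul_one] at h

theorem sum_range (d : ℕ → ℂ) (m : ℕ) :
    HasDiskSeries (fun z => ∑ n ∈ Finset.range m, d n * z ^ n)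
      (fun n => if n < m then d n else 0) := by
  intro z _
  have h : HasSum (fun n => (if n < m then d n else 0) * z ^ n) _ :=
    hasSum_sum_of_ne_finset_zero (s := Finset.range m) fun n hn => by simp [Finset.mem_range.not.1 hn]
  rwa [Finset.sum_congr rfl fun n hn => by rw [if_pos (Finset.mem_range.1 hn)]] at h

theorem pow_mul (h : HasDiskSeries F c) (m : ℕ) :
    HasDiskSeries (fun z => z ^ m * F z) (fun n => if n < m then 0 else c (n - m)) := by
  intro z hz
  rw [← hasSum_nat_add_iff' m]
  have h0 : ∑ i ∈ Finset.range m, (if i < m then 0 else c (i - m)) * z ^ i = 0 :=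
    Finset.sum_eq_zero fun n hn => by simp [Finset.mem_range.1 hn]
  rw [h0, sub_zero]
  convert! (h z hz).mul_left (z ^ m) using 2 with n
  simp
  ring

theorem tail (h : HasDiskSeries F c) (m : ℕ) :
    HasDiskSeries (fun z => ∑' n, c (n + m) * z ^ n) (fun n => c (n + m)) := by
  intro z hz
  apply Summable.hasSum
  rcases eq_or_ne z 0 with rfl | hz0
  · apply summable_of_ne_finset_zero (s := {0})
    intro n hn
    simp at hn
    simp [hn]
  · have := ((summable_nat_add_iff m).2 (h z hz).summable).mul_left ((z ^ m)⁻¹)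
    convert! this using 2 with n
    have : z ^ m ≠ 0 := pow_ne_zero _ hz0
    field_simp
    ring

theorem eq_sum_range_add (h : HasDiskSeries F c) (m : ℕ) {z : ℂ} (hz : ‖z‖ < 1) :
    F z = ∑ n ∈ Finset.range m, c n * z ^ n + z ^ m * ∑' n, c (n + m) * z ^ n := by
  rw [← (h z hz).tsum_eq, ← (h z hz).summable.sum_add_tsum_nat_add m, ← tsum_mul_left]
  congr 2 with n
  ring

theorem apply_zero (h : HasDiskSeries F c) : F 0 = c 0 := by
  simpa using h.eq_sum_range_add 1 (z := 0) (by simp)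

end HasDiskSeries

theorem DifferentiableOn.exists_hasDiskSeries {F : ℂ → ℂ}
    (h : DifferentiableOn ℂ F (Metric.ball 0 1)) : ∃ c, HasDiskSeries F c := by
  refine ⟨fun n => (n.factorial : ℂ)⁻¹ * iteratedDeriv n F 0, fun z hz => ?_⟩
  convert! Complex.hasSum_taylorSeries_on_ball h (z := z) (by simpa using hz) using 2 with n
  simp
  ring

/-- Parseval's identity for a power series on the circle of radius `ρ`, with the mean square
expressed as the norm of an element of `L²`. -/
theorem HasDiskSeries.exists_L2 {F : ℂ → ℂ} {c : ℕ → ℂ} (h : HasDiskSeries F c) {ρ : ℝ}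
    (hρ0 : 0 ≤ ρ) (hρ1 : ρ < 1) :
    ∃ u : Lp ℂ 2 (AddCircle.haarAddCircle (T := (1 : ℝ))),
      (∀ᵐ x ∂AddCircle.haarAddCircle, u x = F (ρ * AddCircle.toCircle x)) ∧
      HasSum (fun n => ‖c n‖ ^ 2 * ρ ^ (2 * n)) (‖u‖ ^ 2) := by
  have hs : Summable fun n : ℕ => (c n * (ρ : ℂ) ^ n) • fourier (T := (1 : ℝ)) (n : ℤ) := by
    apply Summable.of_norm
    simp_rw [norm_smul, fourier_norm, mul_one]
    exact (h ρ (by simpa [abs_of_nonneg hρ0] using hρ1)).summable.norm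
  set Φ : C(AddCircle (1 : ℝ), ℂ) := ∑' n : ℕ, (c n * (ρ : ℂ) ^ n) • fourier (n : ℤ) with hΦ
  have hΦs := hs.hasSum
  rw [← hΦ] at hΦs
  refine ⟨ContinuousMap.toLp (E := ℂ) 2 AddCircle.haarAddCircle ℂ Φ, ?_, ?_⟩
  · filter_upwards [ContinuousMap.coeFn_toLp (𝕜 := ℂ) (p := 2)
      (AddCircle.haarAddCircle (T := (1 : ℝ))) Φ] with x hx
    rw [hx]
    have h1 := (ContinuousMap.evalCLM ℂ x).hasSum hΦs
    refine h1.unique ?_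
    convert! h (ρ * AddCircle.toCircle x) (by simpa [abs_of_nonneg hρ0, Circle.norm_coe] using hρ1) using 2 with n
    simp [mul_pow, mul_assoc, AddCircle.toCircle_nsmul]
  · rw [hasSum_iff_tendsto_nat_of_nonneg (fun n => by positivity)]
    have h2 := ((ContinuousMap.toLp (E := ℂ) 2
      (AddCircle.haarAddCircle (T := (1 : ℝ))) ℂ).hasSum hΦs).tendsto_sum_nat.norm.pow 2
    refine h2.congr fun N => ?_
    have hon := (orthonormal_fourier (T := (1 : ℝ))).comp (fun n : ℕ => (n : ℤ))
      Nat.cast_injective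
    have h3 := hon.inner_sum (fun n => c n * (ρ : ℂ) ^ n) (fun n => c n * (ρ : ℂ) ^ n)
      (Finset.range N)
    simp only [map_smul]
    rw [← Complex.ofReal_inj]
    push_cast
    refine (inner_self_eq_norm_sq_to_K (𝕜 := ℂ) _).symm.trans (h3.trans (Finset.sum_congr rfl fun n _ => ?_))
    rw [Complex.conj_mul']
    simp [abs_of_nonneg hρ0, mul_pow, pow_mul']

/-- Pointwise domination on the disk passes to the coefficients in mean square. -/
theorem sum_sq_le_of_norm_le {F G : ℂ → ℂ} {c d : ℕ → ℂ} (hF : HasDiskSeries F c) {m : ℕ}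
    (hG : HasDiskSeries G (fun n => if n < m then d n else 0))
    (hle : ∀ z : ℂ, ‖z‖ < 1 → ‖F z‖ ≤ ‖G z‖) :
    ∑ n ∈ Finset.range m, ‖c n‖ ^ 2 ≤ ∑ n ∈ Finset.range m, ‖d n‖ ^ 2 := by
  have key : ∀ ρ : ℝ, 0 < ρ → ρ < 1 → ∑ n ∈ Finset.range m, ‖c n‖ ^ 2 * ρ ^ (2 * n) ≤
      ∑ n ∈ Finset.range m, ‖d n‖ ^ 2 * ρ ^ (2 * n) := by
    intro ρ h0 h1
    obtain ⟨u, hu, hus⟩ := hF.exists_L2 h0.le h1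
    obtain ⟨v, hv, hvs⟩ := hG.exists_L2 h0.le h1
    have huv : ‖u‖ ≤ ‖v‖ := by
      apply Lp.norm_le_norm_of_ae_le
      filter_upwards [hu, hv] with x hx hx'
      rw [hx, hx']
      exact hle _ (by simpa [abs_of_pos h0, Circle.norm_coe] using h1)
    have e : ∑ n ∈ Finset.range m, ‖d n‖ ^ 2 * ρ ^ (2 * n) = ‖v‖ ^ 2 := by
      rw [← hvs.tsum_eq, tsum_eq_sum (s := Finset.range m)]
      · exact Finset.sum_congr rfl fun n hn => by simp [Finset.mem_range.1 hn]
      · intro n hn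
        simp [Finset.mem_range.not.1 hn]
    rw [e]
    exact (sum_le_hasSum _ (fun n _ => by positivity) hus).trans (by gcongr)
  have lim : ∀ b : ℕ → ℂ, Tendsto (fun ρ : ℝ => ∑ n ∈ Finset.range m, ‖b n‖ ^ 2 * ρ ^ (2 * n))
      (𝓝[<] 1) (𝓝 (∑ n ∈ Finset.range m, ‖b n‖ ^ 2)) := by
    intro b
    have hc : Continuous fun ρ : ℝ => ∑ n ∈ Finset.range m, ‖b n‖ ^ 2 * ρ ^ (2 * n) := by
      fun_prop
    simpa using (hc.tendsto 1).mono_left nhdsWithin_le_nhds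
  refine le_of_tendsto_of_tendsto (lim c) (lim d) ?_
  filter_upwards [Ioo_mem_nhdsLT (zero_lt_one (α := ℝ))] with ρ hρ
  exact key ρ hρ.1 hρ.2

/-- Multiplication by a function bounded by `1` on the disk contracts initial segments of the
coefficient sequence. -/
theorem sum_sq_le_of_eq_mul {F g ψ : ℂ → ℂ} {c d : ℕ → ℂ} (hF : HasDiskSeries F c)
    (hg : HasDiskSeries g d) (hψ : DifferentiableOn ℂ ψ (Metric.ball 0 1))
    (hψ1 : ∀ z : ℂ, ‖z‖ < 1 → ‖ψ z‖ ≤ 1) (hFg : ∀ z : ℂ, ‖z‖ < 1 → F z = ψ z * g z) (m : ℕ) :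
    ∑ n ∈ Finset.range m, ‖c n‖ ^ 2 ≤ ∑ n ∈ Finset.range m, ‖d n‖ ^ 2 := by
  have hp := HasDiskSeries.sum_range d m
  obtain ⟨e, he⟩ := (hψ.mul hp.differentiableOn).exists_hasDiskSeries
  obtain ⟨k, hk⟩ := (hψ.mul (hg.tail m).differentiableOn).exists_hasDiskSeries
  have hce := (hF.sub he).unique ((hk.pow_mul m).congr fun z hz => by
    simp only [Pi.mul_apply]
    rw [hFg z hz, hg.eq_sum_range_add m hz]
    ring)
  have hce' : ∀ n < m, c n = e n := fun n hn => by
    have := congrFun hce n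
    simpa [hn, sub_eq_zero] using this
  rw [Finset.sum_congr rfl fun n hn => by rw [hce' n (Finset.mem_range.1 hn)]]
  refine sum_sq_le_of_norm_le he hp fun z hz => ?_
  simp only [Pi.mul_apply, norm_mul]
  exact mul_le_of_le_one_left (norm_nonneg _) (hψ1 z hz)

theorem norm_sub_le_norm_one_sub_conj_mul {a w : ℂ} (ha : ‖a‖ ≤ 1) (hw : ‖w‖ ≤ 1) :
    ‖w - a‖ ≤ ‖1 - conj a * w‖ := by
  rw [← sq_le_sq₀ (norm_nonneg _) (norm_nonneg _)]
  have ha' : ‖a‖ ^ 2 ≤ 1 := pow_le_one₀ (norm_nonneg _) ha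
  have hw' : ‖w‖ ^ 2 ≤ 1 := pow_le_one₀ (norm_nonneg _) hw
  have := mul_nonneg (sub_nonneg.2 ha') (sub_nonneg.2 hw')
  simp only [Complex.sq_norm, Complex.normSq_apply] at this ⊢
  simp
  nlinarith

/-- Rogosinski's inequality for functions subordinate to a Möbius self-map of the disk. -/
theorem sum_sq_coeff_le {f : ℂ → ℂ} {a : ℕ → ℂ} (hf : HasDiskSeries f a)
    (hf1 : ∀ z : ℂ, ‖z‖ < 1 → ‖f z‖ ≤ 1) (m : ℕ) :
    ∑ n ∈ Finset.range m, ‖a (n + 1)‖ ^ 2 ≤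
      ∑ n ∈ Finset.range m, (1 - ‖a 0‖ ^ 2) ^ 2 * (‖a 0‖ ^ 2) ^ n := by
  have hf0 := hf.apply_zero
  have ha : ‖a 0‖ ≤ 1 := hf0 ▸ hf1 0 (by simp)
  rcases ha.eq_or_lt with ha1 | ha1
  · have h1 := sum_sq_le_of_norm_le (m := m + 1) (d := fun n => if n = 0 then 1 else 0) hf
      (G := fun _ => 1) (by
        convert! HasDiskSeries.const 1 using 2 with n
        rcases n with _ | n <;> simp) (by simpa using hf1)
    rw [Finset.sum_range_succ', Finset.sum_range_succ'] at h1
    simp [ha1] at h1 ⊢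
    exact h1
  set g : ℂ → ℂ := fun z => 1 - conj (a 0) * f z
  have hg := (HasDiskSeries.const 1).sub (hf.const_mul (conj (a 0)))
  have hg0 : ∀ z ∈ Metric.ball (0 : ℂ) 1, g z ≠ 0 := by
    intro z hz h0
    have h2 : ‖conj (a 0) * f z‖ < 1 := by
      rw [norm_mul, RCLike.norm_conj]
      exact mul_lt_one_of_nonneg_of_lt_one_left (norm_nonneg _) ha1 (hf1 z (by simpa using hz))
    rw [← sub_eq_zero.1 h0] at h2
    simp at h2
  set w : ℂ → ℂ := fun z => (f z - a 0) / g z with hwdef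
  have hw : DifferentiableOn ℂ w (Metric.ball 0 1) :=
    (hf.differentiableOn.sub_const _).div hg.differentiableOn hg0
  have hw0 : w 0 = 0 := by simp [hwdef, hf0]
  have hball : Metric.ball (0 : ℂ) 1 ∈ 𝓝 0 := Metric.ball_mem_nhds _ one_pos
  have hψ := (Complex.differentiableOn_dslope hball).2 hw
  have hψ1 : ∀ z : ℂ, ‖z‖ < 1 → ‖dslope w 0 z‖ ≤ 1 := by
    intro z hz
    have := Complex.norm_dslope_le_div_of_mapsTo_ball hw (R₂ := 1) (fun z hz => by
      rw [hw0, mem_closedBall_zero_iff, hwdef, norm_div]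
      exact div_le_one_of_le₀ (norm_sub_le_norm_one_sub_conj_mul ha (hf1 z (by simpa using hz)))
        (norm_nonneg _)) (z := z) (by simpa using hz)
    simpa using this
  obtain ⟨c, hc⟩ := (hψ.mul hg.differentiableOn).exists_hasDiskSeries
  have hca := (hc.pow_mul 1).unique ((hf.sub (HasDiskSeries.const (a 0))).congr fun z hz => by
    have hz' : g z ≠ 0 := hg0 z (by simpa using hz)
    have h3 : z * dslope w 0 z = w z := by
      simpa [hw0] using sub_smul_dslope w 0 z
    change f z - a 0 = z ^ 1 * (dslope w 0 z * g z)
    rw [pow_one, ← mul_assoc, h3, hwdef, div_mul_cancel₀ _ hz'])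
  have hca' : ∀ n, c n = a (n + 1) := fun n => by simpa using congrFun hca (n + 1)
  have main := fun m => sum_sq_le_of_eq_mul hc hg hψ hψ1 (fun z _ => rfl) m
  simp only [hca'] at main
  induction m with
  | zero => simp
  | succ m ih =>
    refine (main (m + 1)).trans ?_
    rw [Finset.sum_range_succ', Finset.sum_range_succ']
    have e0 : ‖(1 : ℂ) - conj (a 0) * a 0‖ ^ 2 = (1 - ‖a 0‖ ^ 2) ^ 2 := by
      rw [Complex.conj_mul', ← Complex.ofReal_pow, ← Complex.ofReal_one, ← Complex.ofReal_sub,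
        Complex.norm_real, Real.norm_eq_abs, sq_abs]
    simp only [Nat.succ_ne_zero, if_false, if_true, zero_sub, norm_neg, norm_mul, RCLike.norm_conj,
      mul_pow, e0, pow_zero, mul_one, ← Finset.mul_sum] at ih ⊢
    simp only [pow_succ (‖a 0‖ ^ 2), ← Finset.sum_mul]
    nlinarith [mul_le_mul_of_nonneg_left ih (sq_nonneg ‖a 0‖)]

/-- Abel summation: domination of partial sums is preserved by antitone nonnegative weights. -/
theorem sum_mul_le_sum_mul_of_antitone {v x y : ℕ → ℝ} (hv : Antitone v) (hv0 : ∀ n, 0 ≤ v n)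
    (hxy : ∀ m, ∑ n ∈ Finset.range m, x n ≤ ∑ n ∈ Finset.range m, y n) (m : ℕ) :
    ∑ n ∈ Finset.range m, v n * x n ≤ ∑ n ∈ Finset.range m, v n * y n := by
  suffices h : v m * (∑ n ∈ Finset.range m, y n - ∑ n ∈ Finset.range m, x n) ≤
      ∑ n ∈ Finset.range m, v n * y n - ∑ n ∈ Finset.range m, v n * x n by
    have := mul_nonneg (hv0 m) (sub_nonneg.2 (hxy m))
    linarith
  induction m with
  | zero => simp
  | succ m ih =>
    have h1 := mul_le_mul_of_nonneg_right (hv m.le_succ) (sub_nonneg.2 (hxy (m + 1)))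
    simp only [Nat.succ_eq_add_one, Finset.sum_range_succ] at h1 ⊢
    linarith

theorem antitone_succ_mul_pow {t : ℝ} (ht0 : 0 ≤ t) (ht : t ≤ 1 / 2) :
    Antitone fun n : ℕ => ((n : ℝ) + 1) * t ^ (n + 1) := by
  refine antitone_nat_of_succ_le fun n => ?_
  have h1 : ((n : ℝ) + 2) * t ≤ n + 1 := by
    nlinarith [(Nat.cast_nonneg n : (0 : ℝ) ≤ n)]
  have h2 := mul_le_mul_of_nonneg_right h1 (pow_nonneg ht0 (n + 1))
  push_cast
  calc ((n : ℝ) + 1 + 1) * t ^ (n + 1 + 1) = (n + 2) * t * t ^ (n + 1) := by ring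
    _ ≤ _ := h2

theorem SrOverPi_le {f : ℂ → ℂ} {a : ℕ → ℂ} (hf : InClassB f a) {r : ℝ}
    (hr : r ^ 2 ≤ 1 / 2) :
    SrOverPi a r ≤ r ^ 2 * (1 - ‖a 0‖ ^ 2) ^ 2 / (1 - ‖a 0‖ ^ 2 * r ^ 2) ^ 2 := by
  have hs := sum_sq_coeff_le hf.1 hf.2
  have ha : ‖a 0‖ ^ 2 ≤ 1 :=
    pow_le_one₀ (norm_nonneg _) (HasDiskSeries.apply_zero hf.1 ▸ hf.2 0 (by simp))
  have hlt : ‖‖a 0‖ ^ 2 * r ^ 2‖ < 1 := by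
    rw [Real.norm_of_nonneg (by positivity)]
    nlinarith [sq_nonneg r]
  have hsum := (hasSum_choose_mul_geometric_of_norm_lt_one 1 hlt).mul_left
    (r ^ 2 * (1 - ‖a 0‖ ^ 2) ^ 2)
  rw [mul_one_div] at hsum
  refine Real.tsum_le_of_sum_range_le (fun n => by rw [pow_mul]; positivity) fun m => ?_
  refine le_trans ?_ (sum_le_hasSum (Finset.range m) (fun n _ => by positivity) hsum)
  have := sum_mul_le_sum_mul_of_antitone (antitone_succ_mul_pow (sq_nonneg r) hr)
    (fun n => by positivity) hs m
  refine le_of_eq_of_le (Finset.sum_congr rfl fun n _ => ?_)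
    (this.trans_eq (Finset.sum_congr rfl fun n _ => ?_))
  · rw [pow_mul]
    ring
  · simp
    ring

theorem stmt_16 (f : ℂ → ℂ) (a : ℕ → ℂ) (hf : InClassB f a)
    (r : ℝ) (hr0 : 0 < r) (hr1 : r ≤ 1 / Real.sqrt 2) :
    1 - SrOverPi a r ≥ (1 - r ^ 2) * (1 - r ^ 2 * ‖a 0‖ ^ 4) / (1 - ‖a 0‖ ^ 2 * r ^ 2) ^ 2 ∧
    SrOverPi a r / (1 - SrOverPi a r)
      ≤ r ^ 2 * (1 - ‖a 0‖ ^ 2) ^ 2 / ((1 - r ^ 2) * (1 - r ^ 2 * ‖a 0‖ ^ 4)) := by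
  have hr : r ^ 2 ≤ 1 / 2 := by
    have := pow_le_pow_left₀ hr0.le hr1 2
    rwa [div_pow, Real.sq_sqrt (by norm_num), one_pow] at this
  have hS := SrOverPi_le hf hr
  have ha : ‖a 0‖ ^ 2 ≤ 1 :=
    pow_le_one₀ (norm_nonneg _) (HasDiskSeries.apply_zero hf.1 ▸ hf.2 0 (by simp))
  have h4 : ‖a 0‖ ^ 4 = (‖a 0‖ ^ 2) ^ 2 := by ring
  rw [h4]
  set A := ‖a 0‖ ^ 2 with hA
  have hA0 : 0 ≤ A := by positivity
  set t := r ^ 2 with ht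
  have ht0 : 0 ≤ t := by positivity
  set S := SrOverPi a r
  have hD : 0 < 1 - A * t := by nlinarith
  have hA2 : A ^ 2 ≤ 1 := pow_le_one₀ hA0 ha
  have hP : 0 < (1 - t) * (1 - t * A ^ 2) := mul_pos (by linarith) (by nlinarith)
  have hid : (1 - t) * (1 - t * A ^ 2) = (1 - A * t) ^ 2 - t * (1 - A) ^ 2 := by ring
  have hS1 : (1 - t) * (1 - t * A ^ 2) / (1 - A * t) ^ 2 ≤ 1 - S := by
    rw [hid, sub_div, div_self (by positivity)]
    linarith
  refine ⟨hS1, ?_⟩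
  have hpos : 0 < 1 - S := lt_of_lt_of_le (by positivity) hS1
  rw [div_le_div_iff₀ hpos hP, hid]
  rw [le_div_iff₀ (by positivity)] at hS
  linarith
end

section
/- Let M > 0 and let f = h + conj(g) ∈ P⁰_H(M) with h(z) = z + Σ_{n=2}^∞ a_n z^n and g(z) = Σ_{n=2}^∞ b_n z^n. Then for every n ≥ 2: (i) |a_n| + |b_n| ≤ 2M/(n(n−1)); (ii) ||a_n| − |b_n|| ≤ 2M/(n(n−1)); (iii) |a_n| ≤ 2M/(n(n−1)). -/
/-- Membership of `f = h + conj g` in the class `P⁰_H(M)`: `h(z) = z + Σ_{n≥2} a_n zⁿ`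
and `g(z) = Σ_{n≥2} b_n zⁿ` are analytic on the unit disk (given here by convergent
power series), and `Re(z h″(z)) > −M + |z g″(z)|` on the disk. -/
def InP0H (M : ℝ) (h g : ℂ → ℂ) (a b : ℕ → ℂ) : Prop :=
  a 0 = 0 ∧ a 1 = 1 ∧ b 0 = 0 ∧ b 1 = 0 ∧
  (∀ z : ℂ, ‖z‖ < 1 → HasSum (fun n => a n * z ^ n) (h z)) ∧
  (∀ z : ℂ, ‖z‖ < 1 → HasSum (fun n => b n * z ^ n) (g z)) ∧
  (∀ z : ℂ, ‖z‖ < 1 → (z * iteratedDeriv 2 h z).re > -M + ‖z * iteratedDeriv 2 g z‖)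

open Real in
lemma norm_circleAverage_le_circleAverage_norm {E : Type*} [NormedAddCommGroup E]
    [NormedSpace ℝ E] (f : ℂ → E) (c : ℂ) (R : ℝ) :
    ‖circleAverage f c R‖ ≤ circleAverage (fun z ↦ ‖f z‖) c R := by
  rw [circleAverage_def, circleAverage_def, norm_smul, smul_eq_mul,
    norm_of_nonneg (by positivity)]
  gcongr
  exact intervalIntegral.norm_integral_le_integral_norm two_pi_pos.le

lemma hasFPowerSeriesOnBall_ofScalars_of_hasSum {F : ℂ → ℂ} {c : ℕ → ℂ}
    (hF : ∀ z : ℂ, ‖z‖ < 1 → HasSum (fun n ↦ c n * z ^ n) (F z)) :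
    HasFPowerSeriesOnBall F (FormalMultilinearSeries.ofScalars ℂ c) 0 1 where
  r_le := by
    refine ENNReal.le_of_forall_nnreal_lt fun r hr ↦ ?_
    have hr' : ‖((r : ℝ) : ℂ)‖ < 1 := by simpa using hr
    refine FormalMultilinearSeries.le_radius_of_tendsto _ (l := 0) ?_
    have h := (hF _ hr').summable.tendsto_atTop_zero.norm
    simpa [FormalMultilinearSeries.ofScalars_norm] using h
  r_pos := by simp
  hasSum := by
    intro z hz
    have hz' : ‖z‖ < 1 := by simpa [← ENNReal.ofReal_one, Metric.eball_ofReal] using hz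
    simpa [FormalMultilinearSeries.ofScalars_apply_eq, mul_comm] using hF z hz'

open Metric in
lemma differentiableOn_of_hasSum_mul_pow {F : ℂ → ℂ} {c : ℕ → ℂ}
    (hF : ∀ z : ℂ, ‖z‖ < 1 → HasSum (fun n ↦ c n * z ^ n) (F z)) :
    DifferentiableOn ℂ F (ball 0 1) := by
  have h := (hasFPowerSeriesOnBall_ofScalars_of_hasSum hF).differentiableOn
  rwa [← ENNReal.ofReal_one, Metric.eball_ofReal] at h

lemma iteratedDeriv_zero_of_hasSum_mul_pow {F : ℂ → ℂ} {c : ℕ → ℂ}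
    (hF : ∀ z : ℂ, ‖z‖ < 1 → HasSum (fun n ↦ c n * z ^ n) (F z)) (n : ℕ) :
    iteratedDeriv n F 0 = n.factorial * c n := by
  have h := hasFPowerSeriesOnBall_ofScalars_of_hasSum hF
  have h' := h.factorial_smul 1 n
  rw [iteratedDeriv_eq_iteratedFDeriv, ← h']
  simp

open Metric in
/-- Termwise second derivative of a power series converging on the unit disk. -/
lemma hasSum_iteratedDeriv_two {F : ℂ → ℂ} {c : ℕ → ℂ}
    (hF : ∀ z : ℂ, ‖z‖ < 1 → HasSum (fun n ↦ c n * z ^ n) (F z)) {z : ℂ} (hz : ‖z‖ < 1) :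
    HasSum (fun n : ℕ ↦ (n + 2) * (n + 1) * c (n + 2) * z ^ n) (iteratedDeriv 2 F z) := by
  have hd : DifferentiableOn ℂ (iteratedDeriv 2 F) (ball 0 1) := by
    rw [iteratedDeriv_succ, iteratedDeriv_one]
    exact ((differentiableOn_of_hasSum_mul_pow hF).deriv isOpen_ball).deriv isOpen_ball
  have h := Complex.hasSum_taylorSeries_on_ball (r := 1) (by simpa using hd)
    (show z ∈ ball 0 ((1 : NNReal) : ℝ) by simpa using hz)
  convert! h using 2 with n
  have h2 : iteratedDeriv n (iteratedDeriv 2 F) 0 = iteratedDeriv (n + 2) F 0 := by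
    simp only [iteratedDeriv_eq_iterate, ← Function.iterate_add_apply]
  have hn : ((n.factorial : ℕ) : ℂ) ≠ 0 := by exact_mod_cast n.factorial_ne_zero
  rw [h2, iteratedDeriv_zero_of_hasSum_mul_pow hF, Nat.factorial_succ, Nat.factorial_succ]
  simp only [smul_eq_mul, sub_zero]
  push_cast
  field_simp
  ring

open Metric Real in
/-- **Carathéodory's coefficient estimate** on a circle of radius `r < 1`. -/
lemma norm_coeff_mul_pow_le_of_re_nonneg {F : ℂ → ℂ} {c : ℕ → ℂ}
    (hF : ∀ z : ℂ, ‖z‖ < 1 → HasSum (fun n ↦ c n * z ^ n) (F z))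
    (hre : ∀ z : ℂ, ‖z‖ < 1 → 0 ≤ (F z).re) {k : ℕ} (hk : k ≠ 0)
    {r : ℝ} (hr0 : 0 < r) (hr1 : r < 1) :
    ‖c k‖ * r ^ k ≤ 2 * (F 0).re := by
  have hd := differentiableOn_of_hasSum_mul_pow hF
  have hsub : closedBall (0 : ℂ) r ⊆ ball 0 1 := closedBall_subset_ball hr1
  have hdr : DifferentiableOn ℂ F (closedBall 0 r) := hd.mono hsub
  have hsph : ∀ z ∈ sphere (0 : ℂ) |r|, ‖z‖ = r := by
    intro z hz
    simpa [abs_of_pos hr0] using hz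
  have hcs : ContinuousOn F (sphere 0 r) := hdr.continuousOn.mono sphere_subset_closedBall
  have hpow : ContinuousOn (fun z : ℂ ↦ (z ^ k)⁻¹) (sphere 0 r) := by
    refine ContinuousOn.inv₀ (by fun_prop) fun z hz ↦ pow_ne_zero _ ?_
    rw [← norm_pos_iff]
    simp_all
  have hmean : ∀ G : ℂ → ℂ, DifferentiableOn ℂ G (closedBall 0 r) →
      circleAverage G 0 r = G 0 := by
    intro G hG
    refine DiffContOnCl.circleAverage ?_
    rw [abs_of_pos hr0]
    exact hG.diffContOnCl_ball subset_rfl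
  have hcoeff : circleAverage (fun z ↦ (z ^ k)⁻¹ * F z) 0 r = c k := by
    rw [circleAverage_eq_circleIntegral hr0.ne']
    have h := hdr.circleIntegral_one_div_sub_center_pow_smul hr0 k
    rw [iteratedDeriv_zero_of_hasSum_mul_pow hF] at h
    have hn : ((k.factorial : ℕ) : ℂ) ≠ 0 := by exact_mod_cast k.factorial_ne_zero
    have h' : (∮ z in C(0, r), (z - 0)⁻¹ • ((z ^ k)⁻¹ * F z)) =
        2 * π * Complex.I * c k := by
      calc _ = ∮ z in C(0, r), (1 / (z - 0) ^ (k + 1)) • F z := by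
            congr 1
            ext z
            simp [pow_succ]
            ring
        _ = _ := by
            rw [h]
            simp only [smul_eq_mul]
            field_simp
    rw [h', smul_eq_mul, inv_mul_cancel_left₀ Complex.two_pi_I_ne_zero]
  have hzero : circleAverage (fun z ↦ (z ^ k)⁻¹ * (starRingEnd ℂ) (F z)) 0 r = 0 := by
    have h := hmean (fun z ↦ z ^ k * F z) (by fun_prop)
    have hint : CircleIntegrable (fun z ↦ z ^ k * F z) 0 r :=
      ContinuousOn.circleIntegrable hr0.le (by fun_prop)
    have h2 := Complex.conjCLE.toContinuousLinearMap.circleAverage_comp_comm hint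
    rw [h] at h2
    have h3 : circleAverage (fun z ↦ (z ^ k)⁻¹ * (starRingEnd ℂ) (F z)) 0 r =
        circleAverage (((r : ℂ) ^ (2 * k))⁻¹ •
          (Complex.conjCLE.toContinuousLinearMap ∘ fun z ↦ z ^ k * F z)) 0 r := by
      refine circleAverage_congr_sphere fun z hz ↦ ?_
      have hz0 : z ≠ 0 := by
        rw [← norm_pos_iff, hsph z hz]
        exact hr0
      have hzz : (starRingEnd ℂ) z = (r : ℂ) ^ 2 * z⁻¹ := by
        rw [eq_mul_inv_iff_mul_eq₀ hz0, Complex.conj_mul', hsph z hz]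
      have hrc : (r : ℂ) ≠ 0 := by exact_mod_cast hr0.ne'
      simp only [Pi.smul_apply, Function.comp_apply, ContinuousLinearEquiv.coe_coe,
        Complex.conjCLE_apply, map_mul, map_pow, hzz, smul_eq_mul]
      rw [mul_pow, ← pow_mul, inv_pow]
      field_simp
    rw [h3, circleAverage_smul, h2]
    simp [hk]
  have hadd : circleAverage (fun z ↦ (z ^ k)⁻¹ * (2 * (F z).re : ℝ)) 0 r = c k := by
    have hi1 : CircleIntegrable (fun z ↦ (z ^ k)⁻¹ * F z) 0 r :=
      ContinuousOn.circleIntegrable hr0.le (hpow.mul hcs)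
    have hi2 : CircleIntegrable (fun z ↦ (z ^ k)⁻¹ * (starRingEnd ℂ) (F z)) 0 r :=
      ContinuousOn.circleIntegrable hr0.le
        (hpow.mul (Complex.continuous_conj.comp_continuousOn hcs))
    have h := circleAverage_fun_add hi1 hi2
    simpa only [← mul_add, Complex.add_conj, hcoeff, hzero, add_zero] using h
  have hre0 : circleAverage (fun z ↦ (F z).re) 0 r = (F 0).re := by
    rw [← hmean F hdr]
    exact Complex.reCLM.circleAverage_comp_comm (ContinuousOn.circleIntegrable hr0.le hcs)
  have hnorm := norm_circleAverage_le_circleAverage_norm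
    (fun z ↦ (z ^ k)⁻¹ * ((2 * (F z).re : ℝ) : ℂ)) 0 r
  have heq : circleAverage (fun z ↦ ‖(z ^ k)⁻¹ * ((2 * (F z).re : ℝ) : ℂ)‖) 0 r =
      circleAverage (((r ^ k)⁻¹ * 2) • fun z ↦ (F z).re) 0 r := by
    refine circleAverage_congr_sphere fun z hz ↦ ?_
    have h0 := hre z (by rw [hsph z hz]; exact hr1)
    simp only [norm_mul, norm_inv, norm_pow, hsph z hz, Complex.norm_real, norm_of_nonneg h0,
      Pi.smul_apply, smul_eq_mul, Real.norm_ofNat]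
    ring
  rw [hadd, heq, circleAverage_smul, hre0, smul_eq_mul] at hnorm
  calc ‖c k‖ * r ^ k ≤ (r ^ k)⁻¹ * 2 * (F 0).re * r ^ k := by gcongr
    _ = 2 * (F 0).re := by field_simp

open Filter Topology in
/-- **Carathéodory's coefficient estimate** for power series with nonnegative real part on the
unit disk. -/
lemma norm_coeff_le_of_re_nonneg {F : ℂ → ℂ} {c : ℕ → ℂ}
    (hF : ∀ z : ℂ, ‖z‖ < 1 → HasSum (fun n ↦ c n * z ^ n) (F z))
    (hre : ∀ z : ℂ, ‖z‖ < 1 → 0 ≤ (F z).re) {k : ℕ} (hk : k ≠ 0) :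
    ‖c k‖ ≤ 2 * (F 0).re := by
  have ht : Tendsto (fun r : ℝ ↦ ‖c k‖ * r ^ k) (𝓝[<] 1) (𝓝 (‖c k‖ * 1 ^ k)) :=
    (Continuous.tendsto (by fun_prop) 1).mono_left nhdsWithin_le_nhds
  rw [one_pow, mul_one] at ht
  refine le_of_tendsto ht ?_
  filter_upwards [Ioo_mem_nhdsLT (zero_lt_one (α := ℝ))] with r hr
  exact norm_coeff_mul_pow_le_of_re_nonneg hF hre hk hr.1 hr.2

lemma exists_norm_eq_one_norm_add_mul_eq (x y : ℂ) :
    ∃ ε : ℂ, ‖ε‖ = 1 ∧ ‖x + ε * y‖ = ‖x‖ + ‖y‖ := by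
  rcases eq_or_ne x 0 with rfl | hx
  · exact ⟨1, by simp⟩
  rcases eq_or_ne y 0 with rfl | hy
  · exact ⟨1, by simp⟩
  have hx' : (‖x‖ : ℂ) ≠ 0 := by simpa using hx
  have hy' : (‖y‖ : ℂ) ≠ 0 := by simpa using hy
  refine ⟨x / ‖x‖ * (‖y‖ / y), by simp [hx, hy], ?_⟩
  have h : x + x / ‖x‖ * (‖y‖ / y) * y = x / ‖x‖ * ((‖x‖ + ‖y‖ : ℝ) : ℂ) := by
    push_cast
    field_simp
  rw [h, norm_mul, Complex.norm_real, Real.norm_of_nonneg (by positivity)]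
  simp [hx]

lemma InP0H.norm_add_norm_le {M : ℝ} {h g : ℂ → ℂ} {a b : ℕ → ℂ} (hf : InP0H M h g a b) (m : ℕ) :
    (m + 2) * (m + 1) * (‖a (m + 2)‖ + ‖b (m + 2)‖) ≤ 2 * M := by
  obtain ⟨-, -, -, -, hh, hg, hineq⟩ := hf
  obtain ⟨ε, hε, hab⟩ := exists_norm_eq_one_norm_add_mul_eq (a (m + 2)) (b (m + 2))
  let c : ℕ → ℂ := fun n ↦
    Nat.casesOn n (M : ℂ) fun j ↦ (j + 2) * (j + 1) * (a (j + 2) + ε * b (j + 2))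
  let F : ℂ → ℂ := fun z ↦ M + z * (iteratedDeriv 2 h z + ε * iteratedDeriv 2 g z)
  have hF : ∀ z : ℂ, ‖z‖ < 1 → HasSum (fun n ↦ c n * z ^ n) (F z) := by
    intro z hz
    rw [← hasSum_nat_add_iff' 1]
    have hs := ((hasSum_iteratedDeriv_two hh hz).add
      ((hasSum_iteratedDeriv_two hg hz).mul_left ε)).mul_left z
    convert! hs using 1
    · ext n
      simp only [c]
      ring
    · simp [c, F]
  have hre : ∀ z : ℂ, ‖z‖ < 1 → 0 ≤ (F z).re := by
    intro z hz
    have h1 := hineq z hz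
    have h2 := Complex.abs_re_le_norm (ε * (z * iteratedDeriv 2 g z))
    rw [norm_mul, hε, one_mul] at h2
    have h3 : (F z).re = M + (z * iteratedDeriv 2 h z).re
        + (ε * (z * iteratedDeriv 2 g z)).re := by
      rw [← Complex.ofReal_re M, ← Complex.add_re, ← Complex.add_re]
      simp only [F]
      ring_nf
    linarith [neg_abs_le (ε * (z * iteratedDeriv 2 g z)).re]
  have hb := norm_coeff_le_of_re_nonneg hF hre m.succ_ne_zero
  have hm : ‖((m : ℂ) + 2) * (m + 1)‖ = ((m : ℝ) + 2) * (m + 1) := by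
    have : ((m : ℂ) + 2) * (m + 1) = (((m + 2) * (m + 1) : ℕ) : ℂ) := by push_cast; ring
    rw [this, Complex.norm_natCast]
    push_cast
    ring
  simpa [c, F, norm_mul _ (a _ + _), hm, hab, -Complex.norm_mul] using hb

theorem stmt_17 (M : ℝ) (hM : 0 < M)
    (h g : ℂ → ℂ) (a b : ℕ → ℂ) (hf : InP0H M h g a b) :
    ∀ n : ℕ, 2 ≤ n →
      ‖a n‖ + ‖b n‖ ≤ 2 * M / ((n : ℝ) * ((n : ℝ) - 1)) ∧
      |‖a n‖ - ‖b n‖| ≤ 2 * M / ((n : ℝ) * ((n : ℝ) - 1)) ∧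
      ‖a n‖ ≤ 2 * M / ((n : ℝ) * ((n : ℝ) - 1)) := by
  intro n hn
  have ha := norm_nonneg (a n)
  have hb := norm_nonneg (b n)
  have key : ‖a n‖ + ‖b n‖ ≤ 2 * M / ((n : ℝ) * ((n : ℝ) - 1)) := by
    obtain ⟨m, rfl⟩ := Nat.exists_eq_add_of_le' hn
    have hm : ((m + 2 : ℕ) : ℝ) * (((m + 2 : ℕ) : ℝ) - 1) = (m + 2) * (m + 1) := by
      push_cast
      ring
    rw [hm, le_div_iff₀' (by positivity)]
    exact hf.norm_add_norm_le m
  exact ⟨key, abs_le.mpr ⟨by linarith, by linarith⟩, by linarith⟩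
end
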